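/- Let Ψ : [0,1]² → ℝ⁴ be a C³ nondegenerate surface. There is a constant c > 0 (depending on Ψ and p) such that for all N ≥ 2 the following holds: if D is any constant for which the decoupling inequality ‖E_{[0,1]²,Ψ}g‖_{L^p(w_{B_N})} ≤ D (∑_{l(Δ)=N^{-1/2}} ‖E_{Δ,Ψ}g‖_{L^p(w_{B_N})}^p)^{1/p} holds for all g : [0,1]² → ℂ and all balls B_N of radius N, then D ≥ c N^{1/2 − 1/p} when 2 ≤ p ≤ 6, and D ≥ c N^{1 − 4/p} when 6 ≤ p < ∞. (This is witnessed by the test function g = 1_{[0,1]²}.) -/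

import Mathlib

open MeasureTheory Set FourierTransform
open scoped ENNReal RealInnerProductSpace

noncomputable section

/-- ℝ⁴ with the Euclidean metric. -/
abbrev R4 := EuclideanSpace ℝ (Fin 4)

/-- `e(z) = e^{2πiz}`. -/
def e2 (z : ℝ) : ℂ := Complex.exp (2 * Real.pi * Complex.I * z)

/-- The dot product `x · y` in ℝ⁴. -/
def dot4 (x y : R4) : ℝ := ∑ i, x i * y i

/-- View a vector of coordinates as a point of ℝ⁴. -/
def toE (v : Fin 4 → ℝ) : R4 := (WithLp.equiv 2 (Fin 4 → ℝ)).symm v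

/-- The weight `w_B(x) = (1 + |x-c|/R)^{-100}` associated to the ball with center `c`,
radius `R`. -/
def wB (c : R4) (R : ℝ) (x : R4) : ℝ := (1 + dist x c / R) ^ (-(100:ℝ))

/-- The weighted norm `‖F‖_{L^p(w)} = (∫ |F|^p w)^{1/p}` (of a scalar function `F`). -/
def wLp (p : ℝ) (w : R4 → ℝ) (F : R4 → ℝ) : ℝ := (∫ x : R4, |F x| ^ p * w x) ^ (1/p)

/-- The measure `w dx`, used to express weighted `L^p` norms for `p ∈ [1,∞]`. -/
def wMeas (c : R4) (R : ℝ) : Measure R4 := volume.withDensity (fun x => ENNReal.ofReal (wB c R x))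

/-- The extension operator `E_{S,Ψ} g(x) = ∫_S g(t,s) e(x·Ψ(t,s)) dt ds`. -/
def ExtOp (Ψ : ℝ × ℝ → R4) (S : Set (ℝ × ℝ)) (g : ℝ × ℝ → ℂ) (x : R4) : ℂ :=
  ∫ ts in S, g ts * e2 (dot4 x (Ψ ts))

/-- The extension operator of a curve, `E_{S,Φ} h(x) = ∫_S h(t) e(x·Φ(t)) dt`. -/
def ExtC (Φ : ℝ → R4) (S : Set ℝ) (h : ℝ → ℂ) (x : R4) : ℂ :=
  ∫ t in S, h t * e2 (dot4 x (Φ t))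

/-- The axis-parallel square with lower-left corner `o` and side length `l`. -/
def sqr (o : ℝ × ℝ) (l : ℝ) : Set (ℝ × ℝ) := Icc o.1 (o.1 + l) ×ˢ Icc o.2 (o.2 + l)

/-- The unit square `[0,1]²`. -/
def unitSq : Set (ℝ × ℝ) := Icc (0:ℝ) 1 ×ˢ Icc (0:ℝ) 1

/-- The square of the standard partition of `[0,1]²` into squares of side `δ` indexed
by `ij`. -/
def gridSq (δ : ℝ) (ij : ℕ × ℕ) : Set (ℝ × ℝ) := sqr (ij.1 * δ, ij.2 * δ) δ

/-- Index set for the standard partition of `[0,1]²` into squares of side `δ`. -/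
def gridIdx (δ : ℝ) : Finset (ℕ × ℕ) := Finset.range ⌈δ⁻¹⌉₊ ×ˢ Finset.range ⌈δ⁻¹⌉₊

/-- Partial derivative `Ψ_t`. -/
def Ψt (Ψ : ℝ × ℝ → R4) (q : ℝ × ℝ) : Fin 4 → ℝ := fun i => deriv (fun u => Ψ (u, q.2) i) q.1
/-- Partial derivative `Ψ_s`. -/
def Ψs (Ψ : ℝ × ℝ → R4) (q : ℝ × ℝ) : Fin 4 → ℝ := fun i => deriv (fun v => Ψ (q.1, v) i) q.2
/-- Partial derivative `Ψ_tt`. -/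
def Ψtt (Ψ : ℝ × ℝ → R4) (q : ℝ × ℝ) : Fin 4 → ℝ :=
  fun i => iteratedDeriv 2 (fun u => Ψ (u, q.2) i) q.1
/-- Partial derivative `Ψ_ss`. -/
def Ψss (Ψ : ℝ × ℝ → R4) (q : ℝ × ℝ) : Fin 4 → ℝ :=
  fun i => iteratedDeriv 2 (fun v => Ψ (q.1, v) i) q.2
/-- Partial derivative `Ψ_ts`. -/
def Ψts (Ψ : ℝ × ℝ → R4) (q : ℝ × ℝ) : Fin 4 → ℝ :=
  fun i => deriv (fun u => deriv (fun v => Ψ (u, v) i) q.2) q.1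

/-- Nondegeneracy at a point: `rank [Ψ_t, Ψ_s, Ψ_tt, Ψ_ss, Ψ_ts] = 4`. -/
def NonDegAt (Ψ : ℝ × ℝ → R4) (q : ℝ × ℝ) : Prop :=
  (Matrix.of ![Ψt Ψ q, Ψs Ψ q, Ψtt Ψ q, Ψss Ψ q, Ψts Ψ q]).rank = 4

/-- Nondegeneracy of a surface: `rank [Ψ_t, Ψ_s, Ψ_tt, Ψ_ss, Ψ_ts] = 4` on `[0,1]²`. -/
def NonDegSurf (Ψ : ℝ × ℝ → R4) : Prop := ∀ q ∈ unitSq, NonDegAt Ψ q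

/-- Nondegeneracy of a curve: `inf_{t_i ∈ [0,1]} |det[φ_j^{(i)}(t_i)]| > 0`. -/
def NonDegCurve (Φ : ℝ → R4) : Prop :=
  ∃ c > 0, ∀ t : Fin 4 → ℝ, (∀ i, t i ∈ Icc (0:ℝ) 1) →
    c ≤ |(Matrix.of (fun i j : Fin 4 => iteratedDeriv ((i:ℕ) + 1) (fun u => Φ u j) (t i))).det|

/-- The quadratic surface `Ψ_A(t,s) = (t, s, A₁t²+2A₂ts+A₃s², A₄t²+2A₅ts+A₆s²)`. -/
def ΨA (A : Fin 6 → ℝ) (q : ℝ × ℝ) : R4 :=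
  toE ![q.1, q.2, A 0 * q.1^2 + 2 * A 1 * q.1 * q.2 + A 2 * q.2^2,
        A 3 * q.1^2 + 2 * A 4 * q.1 * q.2 + A 5 * q.2^2]

/-- `c_{1,A} = A₁A₅ − A₂A₄`. -/
def cA1 (A : Fin 6 → ℝ) : ℝ := A 0 * A 4 - A 1 * A 3
/-- `c_{2,A} = A₁A₆ − A₃A₄`. -/
def cA2 (A : Fin 6 → ℝ) : ℝ := A 0 * A 5 - A 2 * A 3
/-- `c_{3,A} = A₆A₂ − A₅A₃`. -/
def cA3 (A : Fin 6 → ℝ) : ℝ := A 5 * A 1 - A 4 * A 2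

/-- `ν`-transversality of two sets, relative to the quadratic surface `Ψ_A`. -/
def Transverse (A : Fin 6 → ℝ) (ν : ℝ) (S₁ S₂ : Set (ℝ × ℝ)) : Prop :=
  ∀ q₁ ∈ S₁, ∀ q₂ ∈ S₂,
    ν ≤ cA1 A * (q₁.1 - q₂.1)^2 + cA2 A * (q₁.1 - q₂.1) * (q₁.2 - q₂.2)
          + cA3 A * (q₁.2 - q₂.2)^2

/-- The family `𝓛` of coefficient vectors. -/
def LSet (CP : ℝ) : Set (Fin 6 → ℝ) :=
  {A | (∀ i, |A i| ≤ CP) ∧ CP⁻¹ ≤ max |cA1 A| (max |cA2 A| |cA3 A|)}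

/-! ### Basic facts -/

lemma dot4_eq (x y : R4) : dot4 x y = inner ℝ y x := by
  simp [dot4, PiLp.inner_apply]

lemma abs_dot4_le (x y : R4) : |dot4 x y| ≤ ‖x‖ * ‖y‖ := by
  rw [dot4_eq, mul_comm]; exact abs_real_inner_le_norm y x

lemma dot4_sub (x y z : R4) : dot4 x (y - z) = dot4 x y - dot4 x z := by
  simp [dot4_eq, inner_sub_left]

lemma e2_eq (z : ℝ) : e2 z = Complex.exp ((2 * Real.pi * z : ℝ) * Complex.I) := by
  unfold e2; congr 1; push_cast; ring

lemma norm_e2 (z : ℝ) : ‖e2 z‖ = 1 := by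
  rw [e2_eq, Complex.norm_exp_ofReal_mul_I]

lemma e2_re (z : ℝ) : (e2 z).re = Real.cos (2 * Real.pi * z) := by
  rw [e2_eq, Complex.exp_ofReal_mul_I_re]

lemma e2_add (a b : ℝ) : e2 (a + b) = e2 a * e2 b := by
  unfold e2; rw [← Complex.exp_add]; congr 1; push_cast; ring

lemma e2_conj (a : ℝ) : (starRingEnd ℂ) (e2 a) = e2 (-a) := by
  rw [e2_eq, e2_eq, ← Complex.exp_conj]; congr 1
  rw [map_mul, Complex.conj_ofReal, Complex.conj_I]; push_cast; ring

@[fun_prop]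
lemma e2_continuous : Continuous e2 := by
  unfold e2; fun_prop

lemma dot4_continuous : Continuous (fun z : R4 × R4 => dot4 z.1 z.2) := by
  simp only [dot4_eq]; fun_prop

@[fun_prop]
lemma dot4_comp_continuous {α : Type*} [TopologicalSpace α] {f g : α → R4}
    (hf : Continuous f) (hg : Continuous g) : Continuous (fun a => dot4 (f a) (g a)) :=
  dot4_continuous.comp (hf.prodMk hg)

lemma ExtOp_cont {Ψ : ℝ × ℝ → R4} (hΨ : Continuous Ψ) {S : Set (ℝ × ℝ)} {g : ℝ × ℝ → ℂ}
    (hg : IntegrableOn g S) : Continuous (ExtOp Ψ S g) := by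
  unfold ExtOp
  apply continuous_of_dominated (bound := fun q => ‖g q‖)
  · intro x
    exact hg.aestronglyMeasurable.mul (by fun_prop : Continuous _).aestronglyMeasurable
  · intro x
    filter_upwards with q
    simp [norm_e2]
  · exact hg.norm
  · filter_upwards with q
    fun_prop

lemma ExtOp_one_norm_le {Ψ : ℝ × ℝ → R4} {S : Set (ℝ × ℝ)} (hS : volume S ≠ ⊤) (x : R4) :
    ‖ExtOp Ψ S 1 x‖ ≤ volume.real S := by
  unfold ExtOp
  have := norm_setIntegral_le_of_norm_le_const (μ := volume) (s := S) (C := 1)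
    (f := fun ts => (1 : ℝ × ℝ → ℂ) ts * e2 (dot4 x (Ψ ts))) hS.lt_top
    (fun q _ => by simp [norm_e2])
  simpa using this

lemma ExtOp_one_lower {Ψ : ℝ × ℝ → R4} (hΨ : Continuous Ψ) {S : Set (ℝ × ℝ)}
    (hSm : MeasurableSet S) (hS : volume S ≠ ⊤)
    (x : R4) (θ : ℝ) (h : ∀ q ∈ S, |dot4 x (Ψ q) - θ| ≤ 1/6) :
    volume.real S / 2 ≤ ‖ExtOp Ψ S 1 x‖ := by
  have h1 : ‖ExtOp Ψ S 1 x‖ = ‖∫ q in S, e2 (dot4 x (Ψ q) - θ)‖ := by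
    have : ExtOp Ψ S 1 x = e2 θ * ∫ q in S, e2 (dot4 x (Ψ q) - θ) := by
      unfold ExtOp
      rw [← integral_const_mul]
      congr 1; ext q
      rw [← e2_add]; simp
    rw [this, norm_mul, norm_e2, one_mul]
  rw [h1]
  have hIntg : IntegrableOn (fun q => e2 (dot4 x (Ψ q) - θ)) S := by
    refine Measure.integrableOn_of_bounded (M := 1) hS
      (by fun_prop : Continuous _).aestronglyMeasurable ?_
    filter_upwards with q
    simp [norm_e2]
  refine le_trans ?_ (Complex.re_le_norm _)
  have h2 : (∫ q in S, e2 (dot4 x (Ψ q) - θ)).re = ∫ q in S, (e2 (dot4 x (Ψ q) - θ)).re :=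
    (integral_re hIntg).symm
  rw [h2]
  have h3 : ∫ q in S, (1/2 : ℝ) ≤ ∫ q in S, (e2 (dot4 x (Ψ q) - θ)).re := by
    apply setIntegral_mono_on _ hIntg.re hSm
    · intro q hq
      change _ ≤ (e2 (dot4 x (Ψ q) - θ)).re
      rw [e2_re, ← Real.cos_abs, ← Real.cos_pi_div_three]
      apply Real.cos_le_cos_of_nonneg_of_le_pi (abs_nonneg _)
      · linarith [Real.pi_pos]
      · rw [abs_mul, abs_of_pos (by positivity : 0 < 2 * Real.pi)]
        nlinarith [h q hq, Real.pi_pos]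
    · exact integrableOn_const hS
  simp at h3
  linarith

/-! ### The weight -/

lemma wB_eq (N : ℝ) (x : R4) : wB 0 N x = (1 + ‖x‖ / N) ^ (-(100:ℝ)) := by
  simp [wB]

lemma wB_eq' {N : ℝ} (hN : 0 < N) (x : R4) : wB 0 N x = (1 + ‖N⁻¹ • x‖) ^ (-(100:ℝ)) := by
  rw [wB_eq, norm_smul, norm_inv, Real.norm_of_nonneg hN.le]; congr 2; ring

lemma wB_pos {N : ℝ} (hN : 0 < N) (x : R4) : 0 < wB 0 N x := by
  rw [wB_eq]; positivity

lemma wB_lower {N : ℝ} (hN : 0 < N) {x : R4} (hx : ‖x‖ ≤ N) : (2:ℝ) ^ (-(100:ℝ)) ≤ wB 0 N x := by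
  rw [wB_eq]
  apply Real.rpow_le_rpow_of_nonpos (by positivity) _ (by norm_num)
  have : ‖x‖ / N ≤ 1 := by rw [div_le_one hN]; exact hx
  linarith

lemma wB_integrable {N : ℝ} (hN : 0 < N) : Integrable (fun x => wB 0 N x) := by
  have h : Integrable (fun x : R4 => (1 + ‖x‖) ^ (-(100:ℝ))) :=
    integrable_one_add_norm (by simp; norm_num)
  have := h.comp_smul (inv_ne_zero hN.ne')
  simpa only [wB_eq' hN] using this

/-- the mass of the unit weight -/
def W1 : ℝ := ∫ x : R4, wB 0 1 x

lemma wB_integral {N : ℝ} (hN : 0 < N) : ∫ x, wB 0 N x = N ^ 4 * W1 := by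
  unfold W1
  have := Measure.integral_comp_inv_smul (volume : Measure R4) (fun x => (1 + ‖x‖) ^ (-(100:ℝ))) N
  simp only [wB_eq' hN, wB_eq' one_pos]
  rw [this]
  simp [abs_of_pos hN]

lemma W1_pos : 0 < W1 := by
  unfold W1
  rw [integral_pos_iff_support_of_nonneg (fun x => (wB_pos one_pos x).le) (wB_integrable one_pos)]
  have : Function.support (fun x => wB 0 1 x) = univ := by
    ext x; simp [(wB_pos one_pos x).ne']
  rw [this]; simp

lemma wB_continuous {N : ℝ} (hN : 0 < N) : Continuous (fun x => wB 0 N x) := by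
  simp only [wB_eq]
  apply Continuous.rpow_const (by fun_prop)
  intro x; left; positivity

lemma int_pow_wB {N : ℝ} (hN : 0 < N) {F : R4 → ℝ} (hF : Continuous F) {B : ℝ}
    (hB : ∀ x, |F x| ≤ B) {p : ℝ} (hp : 0 ≤ p) : Integrable (fun x => |F x| ^ p * wB 0 N x) := by
  apply Integrable.bdd_mul (wB_integrable hN) (c := B ^ p)
  · exact (hF.abs.rpow_const (fun x => Or.inr hp)).aestronglyMeasurable
  · filter_upwards with x
    rw [Real.norm_of_nonneg (by positivity)]
    exact Real.rpow_le_rpow (abs_nonneg _) (hB x) hp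

/-- lower bound for an integral from a ball -/
lemma int_lower_ball {N : ℝ} (hN : 0 < N) {F : R4 → ℝ} (hi : Integrable (fun x => F x * wB 0 N x))
    (h0 : ∀ x, 0 ≤ F x) {r a : ℝ} (hr : r ≤ N)
    (hF : ∀ x, ‖x‖ ≤ r → a ≤ F x) :
    a * (2:ℝ) ^ (-(100:ℝ)) * volume.real (Metric.closedBall (0:R4) r) ≤ ∫ x, F x * wB 0 N x := by
  calc _ = ∫ x in Metric.closedBall (0:R4) r, a * (2:ℝ) ^ (-(100:ℝ)) := by
        simp; ring
    _ ≤ ∫ x in Metric.closedBall (0:R4) r, F x * wB 0 N x := by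
        apply setIntegral_mono_on _ hi.integrableOn measurableSet_closedBall
        · intro x hx
          rw [mem_closedBall_zero_iff] at hx
          have := wB_lower hN (hx.trans hr)
          have h2 := hF x hx
          gcongr
          exact h0 x
        · exact integrableOn_const (measure_closedBall_lt_top.ne)
    _ ≤ _ := setIntegral_le_integral hi (by
        filter_upwards with x
        exact mul_nonneg (h0 x) (wB_pos hN x).le)

/-- the abstract conclusion -/
lemma concl {p : ℝ} (hp : 2 ≤ p) {I J I0 J0 D : ℝ} (hI0 : 0 < I0) (hI : I0 ≤ I) (hJn : 0 ≤ J)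
    (hJ : J ≤ J0) (hJ0 : 0 < J0) (h : I ^ (1/p) ≤ D * J ^ (1/p)) : (I0 / J0) ^ (1/p) ≤ D := by
  have hp0 : 0 < p := by linarith
  have h1 : 0 < I0 ^ (1/p) := by positivity
  have h2 : I0 ^ (1/p) ≤ I ^ (1/p) := by
    apply Real.rpow_le_rpow hI0.le hI; positivity
  have h3 : 0 ≤ J ^ (1/p) := by positivity
  have h4 : J ^ (1/p) ≤ J0 ^ (1/p) := by
    apply Real.rpow_le_rpow hJn hJ; positivity
  have h5 : 0 < D := by
    by_contra hD
    push Not at hD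
    nlinarith
  rw [Real.div_rpow hI0.le hJ0.le, div_le_iff₀ (by positivity)]
  nlinarith

/-! ### The local L² estimate -/

lemma gauss_e2 {b : ℝ} (hb : 0 < b) (ξ : R4) :
    ∫ x : R4, e2 (dot4 x ξ) * ((Real.exp (-b * ‖x‖ ^ 2) : ℝ) : ℂ) =
      (((Real.pi / b) ^ 2 * Real.exp (-(Real.pi ^ 2 / b) * ‖ξ‖ ^ 2) : ℝ) : ℂ) := by
  have h := GaussianFourier.integral_cexp_neg_mul_sq_norm_add (b := (b:ℂ)) (V := R4)
    (by simpa using hb) (2 * Real.pi * Complex.I) ξ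
  have h1 : ∀ x : R4, e2 (dot4 x ξ) * ((Real.exp (-b * ‖x‖ ^ 2) : ℝ) : ℂ) =
      Complex.exp (-(b:ℂ) * ‖x‖ ^ 2 + 2 * Real.pi * Complex.I * (inner ℝ ξ x : ℝ)) := by
    intro x
    rw [e2, dot4_eq, Complex.ofReal_exp, ← Complex.exp_add]
    congr 1; push_cast; ring
  simp_rw [h1]
  rw [h]
  have h2 : ((Module.finrank ℝ R4 : ℕ) : ℂ) / 2 = ((2:ℕ) : ℂ) := by
    simp; norm_num
  rw [h2, Complex.cpow_natCast]
  push_cast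
  congr 2
  have hb' : (b:ℂ) ≠ 0 := by exact_mod_cast hb.ne'
  field_simp
  rw [Complex.I_sq]; ring

lemma gauss_integrable {b : ℝ} (hb : 0 < b) : Integrable (fun x : R4 => Real.exp (-b * ‖x‖ ^ 2)) := by
  have h := GaussianFourier.integrable_cexp_neg_mul_sq_norm_add (b := (b:ℂ)) (V := R4)
    (by simpa using hb) 0 0
  have := h.norm
  refine this.congr ?_
  filter_upwards with x
  rw [Complex.norm_exp]
  congr 1
  simp [← Complex.ofReal_pow]

lemma gauss2 {β : ℝ} (hβ : 0 < β) :
    Integrable (fun q : ℝ × ℝ => Real.exp (-β * q.1 ^ 2) * Real.exp (-β * q.2 ^ 2)) ∧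
    ∫ q : ℝ × ℝ, Real.exp (-β * q.1 ^ 2) * Real.exp (-β * q.2 ^ 2) = Real.pi / β := by
  constructor
  · exact (integrable_exp_neg_mul_sq hβ).mul_prod (integrable_exp_neg_mul_sq hβ)
  · have := integral_prod_mul (μ := (volume : Measure ℝ)) (ν := (volume : Measure ℝ))
      (fun x : ℝ => Real.exp (-β * x ^ 2)) (fun x : ℝ => Real.exp (-β * x ^ 2))
    rw [← Measure.volume_eq_prod] at this
    rw [this, integral_gaussian, Real.mul_self_sqrt (by positivity)]

lemma prod_norm_sq (q : ℝ × ℝ) : (q.1 ^ 2 + q.2 ^ 2) / 2 ≤ ‖q‖ ^ 2 := by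
  have h1 : |q.1| ≤ ‖q‖ := norm_fst_le q
  have h2 : |q.2| ≤ ‖q‖ := norm_snd_le q
  have := sq_abs q.1
  have := sq_abs q.2
  have := abs_nonneg q.1
  have := abs_nonneg q.2
  nlinarith

lemma gauss_L2_eq {Ψ : ℝ × ℝ → R4} (hΨ : Continuous Ψ) {S : Set (ℝ × ℝ)}
    (hS : volume S ≠ ⊤) {b : ℝ} (hb : 0 < b) :
    ∫ x : R4, ‖ExtOp Ψ S 1 x‖ ^ 2 * Real.exp (-b * ‖x‖ ^ 2) =
      ∫ z : (ℝ × ℝ) × (ℝ × ℝ), (Real.pi / b) ^ 2 *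
        Real.exp (-(Real.pi ^ 2 / b) * ‖Ψ z.1 - Ψ z.2‖ ^ 2)
        ∂((volume.restrict S).prod (volume.restrict S)) := by
  have : IsFiniteMeasure (volume.restrict S) := ⟨by simpa using hS.lt_top⟩
  apply Complex.ofReal_injective
  rw [← integral_complex_ofReal, ← integral_complex_ofReal]
  simp_rw [← gauss_e2 hb]
  have h1 : ∀ x : R4, ((‖ExtOp Ψ S 1 x‖ ^ 2 * Real.exp (-b * ‖x‖ ^ 2) : ℝ) : ℂ) =
      ∫ z : (ℝ × ℝ) × (ℝ × ℝ), e2 (dot4 x (Ψ z.1 - Ψ z.2)) *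
        ((Real.exp (-b * ‖x‖ ^ 2) : ℝ) : ℂ) ∂((volume.restrict S).prod (volume.restrict S)) := by
    intro x
    rw [integral_mul_const]
    push_cast
    congr 1
    rw [← Complex.mul_conj']
    unfold ExtOp
    rw [← integral_conj, ← integral_prod_mul]
    congr 1; ext z
    simp only [Pi.one_apply, one_mul]
    rw [dot4_sub, sub_eq_add_neg, e2_add, e2_conj]
  simp_rw [h1]
  rw [integral_integral_swap]
  refine Integrable.mono' (g := fun w : R4 × ((ℝ × ℝ) × (ℝ × ℝ)) =>
    Real.exp (-b * ‖w.1‖ ^ 2) * 1) ?_ ?_ ?_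
  · exact (gauss_integrable hb).mul_prod (integrable_const (1:ℝ))
  · apply Continuous.aestronglyMeasurable
    unfold Function.uncurry
    fun_prop
  · filter_upwards with w
    simp only [Function.uncurry, norm_mul, norm_e2, Complex.norm_real, mul_one, one_mul]
    rw [Real.norm_of_nonneg (Real.exp_pos _).le]

lemma gauss_L2 {Ψ : ℝ × ℝ → R4} (hΨ : Continuous Ψ) {S : Set (ℝ × ℝ)} (hSm : MeasurableSet S)
    (hS : volume S ≠ ⊤) {κ : ℝ} (hκ : 0 < κ)
    (hanti : ∀ q ∈ S, ∀ q' ∈ S, κ * ‖q - q'‖ ≤ ‖Ψ q - Ψ q'‖) {b : ℝ} (hb : 0 < b) :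
    ∫ x : R4, ‖ExtOp Ψ S 1 x‖ ^ 2 * Real.exp (-b * ‖x‖ ^ 2) ≤
      2 * Real.pi / κ ^ 2 * volume.real S / b := by
  have : IsFiniteMeasure (volume.restrict S) := ⟨by simpa using hS.lt_top⟩
  rw [gauss_L2_eq hΨ hS hb]
  set β : ℝ := Real.pi ^ 2 / b * κ ^ 2 / 2 with hβ
  have hβ0 : 0 < β := by positivity
  obtain ⟨hGi, hGe⟩ := gauss2 hβ0
  set G : ℝ × ℝ → ℝ := fun q => Real.exp (-β * q.1 ^ 2) * Real.exp (-β * q.2 ^ 2) with hG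
  have hIntg : Integrable (fun z : (ℝ × ℝ) × (ℝ × ℝ) => (Real.pi / b) ^ 2 *
        Real.exp (-(Real.pi ^ 2 / b) * ‖Ψ z.1 - Ψ z.2‖ ^ 2))
        ((volume.restrict S).prod (volume.restrict S)) := by
    refine Integrable.mono' (integrable_const ((Real.pi / b) ^ 2))
      (by fun_prop : Continuous _).aestronglyMeasurable ?_
    filter_upwards with z
    rw [Real.norm_of_nonneg (by positivity)]
    have : Real.exp (-(Real.pi ^ 2 / b) * ‖Ψ z.1 - Ψ z.2‖ ^ 2) ≤ 1 := by
      rw [Real.exp_le_one_iff]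
      have : 0 ≤ Real.pi ^ 2 / b * ‖Ψ z.1 - Ψ z.2‖ ^ 2 := by positivity
      linarith
    have h2 : 0 ≤ (Real.pi / b) ^ 2 := by positivity
    nlinarith
  rw [integral_prod _ hIntg]
  have key : ∀ q ∈ S, ∫ q' in S, (Real.pi / b) ^ 2 *
        Real.exp (-(Real.pi ^ 2 / b) * ‖Ψ q - Ψ q'‖ ^ 2) ≤ (Real.pi / b) ^ 2 * (Real.pi / β) := by
    intro q hq
    rw [integral_const_mul]
    gcongr
    have hGs : Integrable (fun q' => G (q - q')) := hGi.comp_sub_left q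
    calc _ ≤ ∫ q' in S, G (q - q') := by
          apply setIntegral_mono_on _ hGs.integrableOn hSm
          · intro q' hq'
            simp only [hG]
            rw [← Real.exp_add, Real.exp_le_exp]
            have h1 := hanti q hq q' hq'
            have h2 := prod_norm_sq (q - q')
            have h3 : (κ * ‖q - q'‖) ^ 2 ≤ ‖Ψ q - Ψ q'‖ ^ 2 := by gcongr
            have h4 : β * ((q - q').1 ^ 2 + (q - q').2 ^ 2) ≤
                Real.pi ^ 2 / b * ‖Ψ q - Ψ q'‖ ^ 2 := by
              calc _ = Real.pi ^ 2 / b * (κ ^ 2 * (((q - q').1 ^ 2 + (q - q').2 ^ 2) / 2)) := by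
                    rw [hβ]; ring
                _ ≤ Real.pi ^ 2 / b * (κ ^ 2 * ‖q - q'‖ ^ 2) := by gcongr
                _ = Real.pi ^ 2 / b * (κ * ‖q - q'‖) ^ 2 := by ring
                _ ≤ _ := by gcongr
            linarith
          · refine Measure.integrableOn_of_bounded (M := 1) hS
              (by fun_prop : Continuous _).aestronglyMeasurable ?_
            filter_upwards with q'
            rw [Real.norm_of_nonneg (by positivity), Real.exp_le_one_iff]
            have : 0 ≤ Real.pi ^ 2 / b * ‖Ψ q - Ψ q'‖ ^ 2 := by positivity
            linarith
      _ ≤ ∫ q', G (q - q') := setIntegral_le_integral hGs (by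
            filter_upwards with q'
            simp only [hG, Pi.zero_apply]; positivity)
      _ = ∫ q', G q' := integral_sub_left_eq_self G volume q
      _ = _ := hGe
  calc _ ≤ ∫ q in S, (Real.pi / b) ^ 2 * (Real.pi / β) := by
        apply setIntegral_mono_on hIntg.integral_prod_left _ hSm key
        exact integrableOn_const hS
    _ = _ := by
        simp
        rw [hβ]
        have := Real.pi_pos
        field_simp

lemma wB_le_gauss {N : ℝ} (hN : 0 < N) (x : R4) :
    ENNReal.ofReal (wB 0 N x) ≤ ∫⁻ t in Ioi (0:ℝ), ENNReal.ofReal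
      (t * Real.exp (-t) * Real.exp (-(t / N ^ 2) * ‖x‖ ^ 2)) := by
  set r := 1 + ‖x‖ ^ 2 / N ^ 2 with hr
  have hr0 : 0 < r := by positivity
  have h := Real.integral_rpow_mul_exp_neg_mul_Ioi (a := 2) (r := r) (by norm_num) hr0
  have hfun : ∀ t : ℝ, t * Real.exp (-t) * Real.exp (-(t / N ^ 2) * ‖x‖ ^ 2) =
      t ^ ((2:ℝ) - 1) * Real.exp (-(r * t)) := by
    intro t
    rw [mul_assoc, ← Real.exp_add]
    norm_num
    left
    rw [hr]; ring
  simp_rw [hfun]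
  rw [← ofReal_integral_eq_lintegral_ofReal, h]
  · apply ENNReal.ofReal_le_ofReal
    rw [wB_eq, Real.Gamma_two, mul_one]
    have h1 : r ≤ (1 + ‖x‖ / N) ^ 2 := by
      rw [hr]
      have : 0 ≤ ‖x‖ / N := by positivity
      have h2 : ‖x‖ ^ 2 / N ^ 2 = (‖x‖ / N) ^ 2 := by ring
      rw [h2]; nlinarith
    have h2 : 1 ≤ 1 + ‖x‖ / N := by
      have : 0 ≤ ‖x‖ / N := by positivity
      linarith
    calc (1 + ‖x‖ / N) ^ (-(100:ℝ)) ≤ (1 + ‖x‖ / N) ^ (-(4:ℝ)) :=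
          Real.rpow_le_rpow_of_exponent_le h2 (by norm_num)
      _ = (((1 + ‖x‖ / N) ^ 2) ^ 2)⁻¹ := by
          rw [Real.rpow_neg (by positivity)]; norm_num; ring
      _ ≤ (r ^ 2)⁻¹ := by gcongr
      _ = _ := by rw [one_div, Real.inv_rpow hr0.le]; norm_num
  · apply Integrable.of_integral_ne_zero
    rw [h, Real.Gamma_two]; positivity
  · filter_upwards [ae_restrict_mem measurableSet_Ioi] with t ht
    have : 0 < t := ht
    simp only [Pi.zero_apply]
    positivity

lemma local_L2 {Ψ : ℝ × ℝ → R4} (hΨ : Continuous Ψ) {S : Set (ℝ × ℝ)} (hSm : MeasurableSet S)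
    (hS : volume S ≠ ⊤) {κ : ℝ} (hκ : 0 < κ)
    (hanti : ∀ q ∈ S, ∀ q' ∈ S, κ * ‖q - q'‖ ≤ ‖Ψ q - Ψ q'‖) {N : ℝ} (hN : 0 < N) :
    ∫ x : R4, ‖ExtOp Ψ S 1 x‖ ^ 2 * wB 0 N x ≤ 2 * Real.pi / κ ^ 2 * volume.real S * N ^ 2 := by
  set A := 2 * Real.pi / κ ^ 2 * volume.real S with hA
  have hA0 : 0 ≤ A := by positivity
  have hE : Continuous (ExtOp Ψ S 1) := ExtOp_cont hΨ (integrableOn_const hS)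
  have hwc := wB_continuous hN
  rw [integral_eq_lintegral_of_nonneg_ae]
  · apply ENNReal.toReal_le_of_le_ofReal (by positivity)
    calc ∫⁻ x : R4, ENNReal.ofReal (‖ExtOp Ψ S 1 x‖ ^ 2 * wB 0 N x)
        ≤ ∫⁻ x : R4, ∫⁻ t in Ioi (0:ℝ), ENNReal.ofReal (‖ExtOp Ψ S 1 x‖ ^ 2) * ENNReal.ofReal
          (t * Real.exp (-t) * Real.exp (-(t / N ^ 2) * ‖x‖ ^ 2)) := by
          apply lintegral_mono
          intro x
          simp only
          rw [ENNReal.ofReal_mul (by positivity), lintegral_const_mul' _ _ ENNReal.ofReal_ne_top]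
          gcongr
          exact wB_le_gauss hN x
      _ = ∫⁻ t in Ioi (0:ℝ), ∫⁻ x : R4, ENNReal.ofReal (‖ExtOp Ψ S 1 x‖ ^ 2) * ENNReal.ofReal
          (t * Real.exp (-t) * Real.exp (-(t / N ^ 2) * ‖x‖ ^ 2)) := by
          apply lintegral_lintegral_swap
          apply Measurable.aemeasurable
          unfold Function.uncurry
          dsimp only
          refine Measurable.fun_mul ?_ ?_
          · exact (by fun_prop : Continuous (fun z : R4 × ℝ => ‖ExtOp Ψ S 1 z.1‖ ^ 2)).measurable.ennreal_ofReal
          · exact (by fun_prop : Continuous (fun z : R4 × ℝ =>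
              z.2 * Real.exp (-z.2) * Real.exp (-(z.2 / N ^ 2) * ‖z.1‖ ^ 2))).measurable.ennreal_ofReal
      _ ≤ ∫⁻ t in Ioi (0:ℝ), ENNReal.ofReal (A * N ^ 2 * Real.exp (-t)) := by
          apply setLIntegral_mono' measurableSet_Ioi
          intro t ht
          have ht0 : 0 < t := ht
          have hb : 0 < t / N ^ 2 := by positivity
          have h1 := gauss_L2 hΨ hSm hS hκ hanti hb
          have hi : Integrable (fun x => ‖ExtOp Ψ S 1 x‖ ^ 2 * Real.exp (-(t / N ^ 2) * ‖x‖ ^ 2)) := by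
            apply Integrable.bdd_mul (gauss_integrable hb) (c := (volume.real S) ^ 2)
            · exact (by fun_prop : Continuous _).aestronglyMeasurable
            · filter_upwards with x
              rw [Real.norm_of_nonneg (by positivity)]
              gcongr
              exact ExtOp_one_norm_le hS x
          calc _ = ∫⁻ x : R4, ENNReal.ofReal (t * Real.exp (-t)) * ENNReal.ofReal
                  (‖ExtOp Ψ S 1 x‖ ^ 2 * Real.exp (-(t / N ^ 2) * ‖x‖ ^ 2)) := by
                congr 1; ext x
                rw [← ENNReal.ofReal_mul (by positivity), ← ENNReal.ofReal_mul (by positivity)]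
                congr 1; ring
            _ = ENNReal.ofReal (t * Real.exp (-t)) * ENNReal.ofReal (∫ x : R4,
                  ‖ExtOp Ψ S 1 x‖ ^ 2 * Real.exp (-(t / N ^ 2) * ‖x‖ ^ 2)) := by
                rw [lintegral_const_mul' _ _ ENNReal.ofReal_ne_top,
                  ofReal_integral_eq_lintegral_ofReal hi]
                filter_upwards with x
                simp only [Pi.zero_apply]; positivity
            _ ≤ ENNReal.ofReal (t * Real.exp (-t)) * ENNReal.ofReal (A / (t / N ^ 2)) := by
                gcongr
            _ = _ := by
                rw [← ENNReal.ofReal_mul (by positivity)]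
                congr 1
                field_simp
      _ = ENNReal.ofReal (A * N ^ 2) := by
          rw [← ofReal_integral_eq_lintegral_ofReal, integral_const_mul, integral_exp_neg_Ioi_zero,
            mul_one]
          · exact (exp_neg_integrableOn_Ioi 0 one_pos |>.congr_fun (fun t _ => by simp)
              measurableSet_Ioi).const_mul _
          · filter_upwards with t
            simp only [Pi.zero_apply]; positivity
  · filter_upwards with x
    simp only [Pi.zero_apply]
    have := wB_pos hN x
    positivity
  · exact (by fun_prop : Continuous _).aestronglyMeasurable

/-! ### Nondegeneracy yields a piece on which `Ψ` is bi-Lipschitz -/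

lemma rank_le_three (M : Fin 5 → Fin 4 → ℝ) (v1 v2 v3 : Fin 4 → ℝ)
    (h : ∀ i, ∃ a b c : ℝ, M i = a • v1 + b • v2 + c • v3) : (Matrix.of M).rank ≤ 3 := by
  rw [Matrix.rank_eq_finrank_span_row]
  have hle : Submodule.span ℝ (range (Matrix.of M).row) ≤ Submodule.span ℝ (range ![v1, v2, v3]) := by
    rw [Submodule.span_le]
    rintro _ ⟨i, rfl⟩
    obtain ⟨a, b, c, habc⟩ := h i
    change M i ∈ _
    rw [habc]
    have h1 : v1 ∈ Submodule.span ℝ (range ![v1, v2, v3]) := Submodule.subset_span ⟨0, rfl⟩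
    have h2 : v2 ∈ Submodule.span ℝ (range ![v1, v2, v3]) := Submodule.subset_span ⟨1, rfl⟩
    have h3 : v3 ∈ Submodule.span ℝ (range ![v1, v2, v3]) := Submodule.subset_span ⟨2, rfl⟩
    exact Submodule.add_mem _ (Submodule.add_mem _ (Submodule.smul_mem _ _ h1)
      (Submodule.smul_mem _ _ h2)) (Submodule.smul_mem _ _ h3)
  refine (Submodule.finrank_mono hle).trans ?_
  have := finrank_range_le_card (R := ℝ) ![v1, v2, v3]
  simpa [Set.finrank] using this

lemma rank_lt_four (a b T S M : Fin 4 → ℝ)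
    (h0 : ∀ i j, a i * b j = a j * b i)
    (h1 : ∀ i j, T i * b j + a i * M j = T j * b i + a j * M i)
    (h2 : ∀ i j, M i * b j + a i * S j = M j * b i + a j * S i) :
    (Matrix.of ![a, b, T, S, M]).rank ≤ 3 := by
  by_cases ha : a = 0
  · by_cases hb : b = 0
    · apply rank_le_three _ T S M
      intro i
      fin_cases i
      · exact ⟨0, 0, 0, by simp [ha]⟩
      · exact ⟨0, 0, 0, by simp [hb]⟩
      · exact ⟨1, 0, 0, by simp⟩
      · exact ⟨0, 1, 0, by simp⟩
      · exact ⟨0, 0, 1, by simp⟩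
    · obtain ⟨k, hk⟩ : ∃ k, b k ≠ 0 := by
        by_contra hcon; push Not at hcon; exact hb (funext hcon)
      apply rank_le_three _ b S M
      intro i
      fin_cases i
      · exact ⟨0, 0, 0, by simp [ha]⟩
      · exact ⟨1, 0, 0, by simp⟩
      · refine ⟨T k / b k, 0, 0, ?_⟩
        ext j
        have := h1 k j
        simp [ha] at this ⊢
        field_simp; linarith
      · exact ⟨0, 1, 0, by simp⟩
      · exact ⟨0, 0, 1, by simp⟩
  · obtain ⟨k, hk⟩ : ∃ k, a k ≠ 0 := by
      by_contra hcon; push Not at hcon; exact ha (funext hcon)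
    apply rank_le_three _ a T M
    intro i
    fin_cases i
    · exact ⟨1, 0, 0, by simp⟩
    · refine ⟨b k / a k, 0, 0, ?_⟩
      ext j
      have := h0 k j
      simp
      field_simp; linarith
    · exact ⟨0, 1, 0, by simp⟩
    · refine ⟨(S k - b k / a k * M k) / a k, 0, b k / a k, ?_⟩
      ext j
      have h3 := h2 k j
      have h4 := h0 k j
      simp
      field_simp
      have h5 : a k * (a k * S j) = a k * (M j * b k + a j * S k - M k * b j) := by
        linear_combination a k * h3
      linear_combination h5 - M k * h4
    · exact ⟨0, 0, 1, by simp⟩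

lemma line_fst (t s : ℝ) : HasDerivAt (fun u : ℝ => (u, s)) ((1:ℝ), (0:ℝ)) t :=
  (hasDerivAt_id t).prodMk (hasDerivAt_const t s)

lemma line_snd (t s : ℝ) : HasDerivAt (fun v : ℝ => (t, v)) ((0:ℝ), (1:ℝ)) s :=
  (hasDerivAt_const s t).prodMk (hasDerivAt_id s)

lemma proj_deriv {f : ℝ → R4} {f' : R4} {t : ℝ} (h : HasDerivAt f f' t) (i : Fin 4) :
    HasDerivAt (fun u => f u i) (f' i) t :=
  (EuclideanSpace.proj i : R4 →L[ℝ] ℝ).hasFDerivAt.comp_hasDerivAt t h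

lemma exists_inj {Ψ : ℝ × ℝ → R4} (hΨ : ContDiff ℝ 3 Ψ) (hnd : NonDegSurf Ψ) :
    ∃ q ∈ Ioo (0:ℝ) 1 ×ˢ Ioo (0:ℝ) 1, (fderiv ℝ Ψ q).ker = ⊥ := by
  by_contra hcon
  push Not at hcon
  have hd : Differentiable ℝ Ψ := hΨ.differentiable (by norm_num)
  have hd2 : Differentiable ℝ (fderiv ℝ Ψ) :=
    (hΨ.fderiv_right (m := 2) (by norm_num)).differentiable (by norm_num)
  set A : ℝ × ℝ → R4 := fun q => fderiv ℝ Ψ q (1, 0) with hA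
  set B : ℝ × ℝ → R4 := fun q => fderiv ℝ Ψ q (0, 1) with hB
  have hAt : ∀ t s i, HasDerivAt (fun u => Ψ (u, s) i) (A (t, s) i) t := fun t s i =>
    proj_deriv ((hd (t, s)).hasFDerivAt.comp_hasDerivAt t (line_fst t s)) i
  have hBs : ∀ t s i, HasDerivAt (fun v => Ψ (t, v) i) (B (t, s) i) s := fun t s i =>
    proj_deriv ((hd (t, s)).hasFDerivAt.comp_hasDerivAt s (line_snd t s)) i
  set H := fun q => fderiv ℝ (fderiv ℝ Ψ) q with hH
  have hdA : ∀ q, HasFDerivAt A ((H q).flip (1, 0)) q := fun q => by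
    have := (hd2 q).hasFDerivAt.clm_apply (hasFDerivAt_const ((1:ℝ), (0:ℝ)) q)
    rw [ContinuousLinearMap.comp_zero, zero_add] at this
    exact this
  have hdB : ∀ q, HasFDerivAt B ((H q).flip (0, 1)) q := fun q => by
    have := (hd2 q).hasFDerivAt.clm_apply (hasFDerivAt_const ((0:ℝ), (1:ℝ)) q)
    rw [ContinuousLinearMap.comp_zero, zero_add] at this
    exact this
  have hAA : ∀ t s i, HasDerivAt (fun u => A (u, s) i) (H (t, s) (1, 0) (1, 0) i) t :=
    fun t s i => proj_deriv (HasFDerivAt.comp_hasDerivAt (l := A) (l' := (H (t, s)).flip (1, 0)) t (hdA (t, s)) (line_fst t s)) i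
  have hAB : ∀ t s i, HasDerivAt (fun v => A (t, v) i) (H (t, s) (0, 1) (1, 0) i) s :=
    fun t s i => proj_deriv (HasFDerivAt.comp_hasDerivAt (l := A) s (hdA (t, s)) (line_snd t s)) i
  have hBA : ∀ t s i, HasDerivAt (fun u => B (u, s) i) (H (t, s) (1, 0) (0, 1) i) t :=
    fun t s i => proj_deriv (HasFDerivAt.comp_hasDerivAt (l := B) (l' := (H (t, s)).flip (0, 1)) t (hdB (t, s)) (line_fst t s)) i
  have hBB : ∀ t s i, HasDerivAt (fun v => B (t, v) i) (H (t, s) (0, 1) (0, 1) i) s :=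
    fun t s i => proj_deriv (HasFDerivAt.comp_hasDerivAt (l := B) s (hdB (t, s)) (line_snd t s)) i
  have hsymm : ∀ q v w, H q v w = H q w v := fun q v w =>
    (hΨ.contDiffAt.isSymmSndFDerivAt (by simp; norm_num)).eq v w
  -- minors vanish
  have hmin : ∀ q ∈ Ioo (0:ℝ) 1 ×ˢ Ioo (0:ℝ) 1, ∀ i j, A q i * B q j - A q j * B q i = 0 := by
    intro q hq i j
    have hne := hcon q hq
    rw [Submodule.ne_bot_iff] at hne
    obtain ⟨v, hv, hv0⟩ := hne
    have hv1 : v.1 • A q + v.2 • B q = 0 := by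
      have h1 : fderiv ℝ Ψ q v = 0 := hv
      have h2 : v = v.1 • ((1:ℝ), (0:ℝ)) + v.2 • ((0:ℝ), (1:ℝ)) := by
        ext <;> simp
      rw [h2, map_add, map_smul, map_smul] at h1
      exact h1
    have hc : ∀ k, v.1 * A q k + v.2 * B q k = 0 := fun k => by
      have := congrArg (fun z : R4 => z k) hv1
      simpa using this
    have hi := hc i
    have hj := hc j
    have e1 : v.1 * (A q i * B q j - A q j * B q i) = 0 := by
      linear_combination B q j * hi - B q i * hj
    have e2 : v.2 * (A q i * B q j - A q j * B q i) = 0 := by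
      linear_combination A q i * hj - A q j * hi
    rcases mul_eq_zero.1 e1 with h | h
    · rcases mul_eq_zero.1 e2 with h' | h'
      · exact absurd (Prod.ext h h') hv0
      · exact h'
    · exact h
  set q0 : ℝ × ℝ := (1/2, 1/2) with hq0
  have hhalf : (1/2 : ℝ) ∈ Ioo (0:ℝ) 1 := by constructor <;> norm_num
  have hnb : ∀ᶠ u in nhds (1/2 : ℝ), u ∈ Ioo (0:ℝ) 1 := Ioo_mem_nhds hhalf.1 hhalf.2
  have hr1 : ∀ i j, H q0 (1,0) (1,0) i * B q0 j + A q0 i * H q0 (1,0) (0,1) j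
      = H q0 (1,0) (1,0) j * B q0 i + A q0 j * H q0 (1,0) (0,1) i := by
    intro i j
    have h1 := ((hAA (1/2) (1/2) i).mul (hBA (1/2) (1/2) j)).sub
      ((hAA (1/2) (1/2) j).mul (hBA (1/2) (1/2) i))
    have h2 : HasDerivAt (fun _ : ℝ => (0:ℝ)) 0 (1/2) := hasDerivAt_const _ _
    have h3 := h1.unique (h2.congr_of_eventuallyEq (by
      filter_upwards [hnb] with u hu
      exact hmin (u, 1/2) ⟨hu, hhalf⟩ i j))
    simp only [← hq0] at h3
    linarith
  have hr2 : ∀ i j, H q0 (1,0) (0,1) i * B q0 j + A q0 i * H q0 (0,1) (0,1) j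
      = H q0 (1,0) (0,1) j * B q0 i + A q0 j * H q0 (0,1) (0,1) i := by
    intro i j
    have h1 := ((hAB (1/2) (1/2) i).mul (hBB (1/2) (1/2) j)).sub
      ((hAB (1/2) (1/2) j).mul (hBB (1/2) (1/2) i))
    have h2 : HasDerivAt (fun _ : ℝ => (0:ℝ)) 0 (1/2) := hasDerivAt_const _ _
    have h3 := h1.unique (h2.congr_of_eventuallyEq (by
      filter_upwards [hnb] with u hu
      exact hmin (1/2, u) ⟨hhalf, hu⟩ i j))
    simp only [← hq0] at h3
    rw [hsymm q0 (1,0) (0,1)]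
    linarith
  have hq0u : q0 ∈ unitSq := ⟨Ioo_subset_Icc_self hhalf, Ioo_subset_Icc_self hhalf⟩
  have hrank := hnd q0 hq0u
  unfold NonDegAt at hrank
  have e1 : Ψt Ψ q0 = fun i => A q0 i := by
    ext i; exact (hAt _ _ i).deriv
  have e2 : Ψs Ψ q0 = fun i => B q0 i := by
    ext i; exact (hBs _ _ i).deriv
  have e3 : Ψtt Ψ q0 = fun i => H q0 (1,0) (1,0) i := by
    ext i
    simp only [Ψtt, iteratedDeriv_succ, iteratedDeriv_zero]
    have : deriv (fun u => Ψ (u, q0.2) i) = fun u => A (u, q0.2) i := by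
      ext u; exact (hAt _ _ i).deriv
    rw [this]; exact (hAA _ _ i).deriv
  have e4 : Ψss Ψ q0 = fun i => H q0 (0,1) (0,1) i := by
    ext i
    simp only [Ψss, iteratedDeriv_succ, iteratedDeriv_zero]
    have : deriv (fun v => Ψ (q0.1, v) i) = fun v => B (q0.1, v) i := by
      ext u; exact (hBs _ _ i).deriv
    rw [this]; exact (hBB _ _ i).deriv
  have e5 : Ψts Ψ q0 = fun i => H q0 (1,0) (0,1) i := by
    ext i
    simp only [Ψts]
    have : (fun u => deriv (fun v => Ψ (u, v) i) q0.2) = fun u => B (u, q0.2) i := by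
      ext u; exact (hBs _ _ i).deriv
    rw [this]; exact (hBA _ _ i).deriv
  have hle := rank_lt_four (Ψt Ψ q0) (Ψs Ψ q0) (Ψtt Ψ q0) (Ψss Ψ q0) (Ψts Ψ q0)
    (by intro i j; rw [e1, e2]
        linarith [hmin q0 ⟨hhalf, hhalf⟩ i j])
    (by intro i j; rw [e1, e2, e3, e5]; exact hr1 i j)
    (by intro i j; rw [e1, e2, e4, e5]; exact hr2 i j)
  omega

lemma exists_piece {Ψ : ℝ × ℝ → R4} (hΨ : ContDiff ℝ 3 Ψ) (hnd : NonDegSurf Ψ) :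
    ∃ q0 : ℝ × ℝ, ∃ r > 0, ∃ κ > 0, Metric.closedBall q0 r ⊆ unitSq ∧
      ∀ q ∈ Metric.closedBall q0 r, ∀ q' ∈ Metric.closedBall q0 r,
        κ * ‖q - q'‖ ≤ ‖Ψ q - Ψ q'‖ := by
  obtain ⟨q0, hq0, hker⟩ := exists_inj hΨ hnd
  have hs : HasStrictFDerivAt Ψ (fderiv ℝ Ψ q0) q0 :=
    hΨ.contDiffAt.hasStrictFDerivAt (by norm_num)
  obtain ⟨K, hK, hanti⟩ := LinearMap.exists_antilipschitzWith
    ((fderiv ℝ Ψ q0) : ℝ × ℝ →ₗ[ℝ] R4) hker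
  have hK' : (0:ℝ) < K := hK
  have hlo := hs.isLittleO.def (c := 1 / (2 * K)) (by positivity)
  have hopen : Ioo (0:ℝ) 1 ×ˢ Ioo (0:ℝ) 1 ∈ nhds q0 :=
    (isOpen_Ioo.prod isOpen_Ioo).mem_nhds hq0
  rw [nhds_prod_eq, Filter.eventually_prod_self_iff'] at hlo
  obtain ⟨U, hU, hUp⟩ := hlo
  obtain ⟨r, hr, hrs⟩ := Metric.nhds_basis_closedBall.mem_iff.1 (Filter.inter_mem hopen hU)
  refine ⟨q0, r, hr, 1 / (2 * K), by positivity, ?_, ?_⟩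
  · intro q hq
    have := (hrs hq).1
    exact ⟨Ioo_subset_Icc_self this.1, Ioo_subset_Icc_self this.2⟩
  · intro q hq q' hq'
    have h1 := hUp q (hrs hq).2 q' (hrs hq').2
    have h2 : ‖q - q'‖ ≤ K * ‖fderiv ℝ Ψ q0 (q - q')‖ := by
      have := hanti.le_mul_dist (q - q') 0
      simpa using this
    have h3 : ‖fderiv ℝ Ψ q0 (q - q')‖ ≤ ‖Ψ q - Ψ q'‖ + ‖Ψ q - Ψ q' - fderiv ℝ Ψ q0 (q - q')‖ := by
      have := norm_sub_le (Ψ q - Ψ q') (Ψ q - Ψ q' - fderiv ℝ Ψ q0 (q - q'))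
      simpa using this
    simp only at h1
    have h4 : ‖q - q'‖ / K ≤ ‖fderiv ℝ Ψ q0 (q - q')‖ := by
      rw [div_le_iff₀ hK']; linarith
    have h5 : ‖q - q'‖ / K = 2 * (1 / (2 * K) * ‖q - q'‖) := by field_simp
    linarith

/-! ### First test function -/

lemma sqr_meas (o : ℝ × ℝ) (l : ℝ) : MeasurableSet (sqr o l) :=
  measurableSet_Icc.prod measurableSet_Icc

lemma sqr_vol (o : ℝ × ℝ) {l : ℝ} (hl : 0 ≤ l) : volume (sqr o l) = ENNReal.ofReal (l ^ 2) := by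
  unfold sqr
  rw [Measure.volume_eq_prod, Measure.prod_prod, Real.volume_Icc, Real.volume_Icc,
    ← ENNReal.ofReal_mul (by linarith)]
  congr 1; ring

lemma sqr_vol_ne (o : ℝ × ℝ) {l : ℝ} (hl : 0 ≤ l) : volume (sqr o l) ≠ ⊤ := by
  rw [sqr_vol o hl]; exact ENNReal.ofReal_ne_top

lemma sqr_vol_real (o : ℝ × ℝ) {l : ℝ} (hl : 0 ≤ l) : volume.real (sqr o l) = l ^ 2 := by
  rw [measureReal_def, sqr_vol o hl, ENNReal.toReal_ofReal (by positivity)]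

lemma wLp_pow {p : ℝ} (hp : 2 ≤ p) {N : ℝ} (hN : 0 < N) (F : R4 → ℝ) :
    wLp p (wB 0 N) F ^ p = ∫ x, |F x| ^ p * wB 0 N x := by
  unfold wLp
  rw [one_div, Real.rpow_inv_rpow _ (by linarith)]
  apply integral_nonneg
  intro x
  have := wB_pos hN x
  simp only [Pi.zero_apply]
  positivity

lemma ExtOp_indicator (Ψ : ℝ × ℝ → R4) (S Q : Set (ℝ × ℝ)) (hQ : MeasurableSet Q) (x : R4) :
    ExtOp Ψ S (Q.indicator 1) x = ExtOp Ψ (S ∩ Q) 1 x := by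
  unfold ExtOp
  rw [← setIntegral_indicator hQ]
  congr 1; ext q
  by_cases hq : q ∈ Q <;> simp [hq]

lemma caseA {Ψ : ℝ × ℝ → R4} (hΨ : ContDiff ℝ 3 Ψ) (hnd : NonDegSurf Ψ)
    {p : ℝ} (hp : 2 ≤ p) :
    ∃ c > 0, ∀ N : ℝ, 2 ≤ N → ∀ D : ℝ,
      (∀ g : ℝ × ℝ → ℂ, IntegrableOn g unitSq → ∀ c₀ : R4,
        wLp p (wB c₀ N) (fun x => ‖ExtOp Ψ unitSq g x‖) ≤
          D * (∑ ij ∈ gridIdx ((Real.sqrt N)⁻¹),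
            wLp p (wB c₀ N) (fun x => ‖ExtOp Ψ (gridSq ((Real.sqrt N)⁻¹) ij) g x‖) ^ p)
            ^ (1/p)) → c * N ^ (1 - 4/p) ≤ D := by
  have hc : Continuous Ψ := hΨ.continuous
  have hp0 : 0 < p := by linarith
  obtain ⟨q0, r, hr, κ, hκ, hQu, hanti⟩ := exists_piece hΨ hnd
  set Q := Metric.closedBall q0 r with hQ
  have hQm : MeasurableSet Q := measurableSet_closedBall
  have hQf : volume Q ≠ ⊤ := measure_closedBall_lt_top.ne
  have hQpos : 0 < volume.real Q :=
    ENNReal.toReal_pos (Metric.measure_closedBall_pos volume q0 hr).ne' hQf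
  obtain ⟨M, hM⟩ := (isCompact_closedBall q0 r).exists_bound_of_continuousOn hc.continuousOn
  have hM0 : 0 ≤ M := (norm_nonneg _).trans (hM q0 (Metric.mem_closedBall_self hr.le))
  set ρ : ℝ := 1 / (6 * (M + 1)) with hρ
  have hρ0 : 0 < ρ := by positivity
  have hρ1 : ρ ≤ 1 := by
    rw [hρ, div_le_one (by positivity)]; linarith
  have hBpos : 0 < volume.real (Metric.closedBall (0:R4) ρ) :=
    ENNReal.toReal_pos (Metric.measure_closedBall_pos volume 0 hρ0).ne'
      measure_closedBall_lt_top.ne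
  set I0 : ℝ := (volume.real Q / 2) ^ p * (2:ℝ) ^ (-(100:ℝ)) *
    volume.real (Metric.closedBall (0:R4) ρ) with hI0
  have hI0pos : 0 < I0 := by positivity
  set C : ℝ := 2 * Real.pi / κ ^ 2 with hC
  have hCpos : 0 < C := by positivity
  refine ⟨(I0 / (4 * C)) ^ (1/p), by positivity, ?_⟩
  intro N hN2 D hD
  have hN : 0 < N := by linarith
  have hsq : 0 < Real.sqrt N := Real.sqrt_pos.2 hN
  have hδ : 0 ≤ (Real.sqrt N)⁻¹ := by positivity
  have hgi : IntegrableOn (Q.indicator (1 : ℝ × ℝ → ℂ)) unitSq := by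
    have : Integrable (Q.indicator (1 : ℝ × ℝ → ℂ)) := by
      rw [integrable_indicator_iff hQm]
      exact integrableOn_const hQf
    exact this.integrableOn
  have h := hD _ hgi 0
  simp_rw [ExtOp_indicator Ψ _ Q hQm, wLp_pow hp hN] at h
  unfold wLp at h
  rw [inter_eq_right.2 hQu] at h
  have hI : I0 ≤ ∫ x, |‖ExtOp Ψ Q 1 x‖| ^ p * wB 0 N x := by
    apply int_lower_ball hN (F := fun x => |‖ExtOp Ψ Q 1 x‖| ^ p)
    · exact int_pow_wB hN (ExtOp_cont hc (integrableOn_const hQf)).norm (B := volume.real Q)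
        (fun x => by rw [abs_norm]; exact ExtOp_one_norm_le hQf x) hp0.le
    · intro x; positivity
    · linarith
    · intro x hx
      rw [abs_norm]
      apply Real.rpow_le_rpow (by positivity) _ hp0.le
      apply ExtOp_one_lower hc hQm hQf x 0
      intro q hq
      rw [sub_zero]
      calc _ ≤ ‖x‖ * ‖Ψ q‖ := abs_dot4_le _ _
        _ ≤ ρ * (M + 1) := by
            gcongr
            linarith [hM q hq]
        _ = 1/6 := by rw [hρ]; field_simp
  have hterm : ∀ ij : ℕ × ℕ, ∫ x, |‖ExtOp Ψ (gridSq (Real.sqrt N)⁻¹ ij ∩ Q) 1 x‖| ^ p * wB 0 N x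
      ≤ C * N ^ (3 - p) := by
    intro ij
    set S := gridSq (Real.sqrt N)⁻¹ ij ∩ Q with hS
    have hSm : MeasurableSet S := (sqr_meas _ _).inter hQm
    have hSf : volume S ≠ ⊤ := measure_ne_top_of_subset inter_subset_right hQf
    have hSv : volume.real S ≤ N⁻¹ := by
      calc volume.real S ≤ volume.real (gridSq (Real.sqrt N)⁻¹ ij) :=
            measureReal_mono inter_subset_left (sqr_vol_ne _ hδ)
        _ = ((Real.sqrt N)⁻¹) ^ 2 := sqr_vol_real _ hδ
        _ = N⁻¹ := by rw [inv_pow, Real.sq_sqrt hN.le]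
    have hL := local_L2 hc hSm hSf hκ
      (fun q hq q' hq' => hanti q hq.2 q' hq'.2) hN
    have hEc := ExtOp_cont hc (S := S) (g := 1) (integrableOn_const hSf)
    have hb : ∀ x, |‖ExtOp Ψ S 1 x‖| ≤ N⁻¹ := fun x => by
      rw [abs_norm]; exact (ExtOp_one_norm_le hSf x).trans hSv
    have hi2 := int_pow_wB hN hEc.norm hb (p := 2) (by norm_num)
    have hip := int_pow_wB hN hEc.norm hb hp0.le
    simp only [abs_norm, Real.rpow_two] at hi2 hip ⊢
    calc ∫ x, ‖ExtOp Ψ S 1 x‖ ^ p * wB 0 N x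
        ≤ ∫ x, (N⁻¹) ^ (p - 2) * (‖ExtOp Ψ S 1 x‖ ^ 2 * wB 0 N x) := by
          apply integral_mono hip (hi2.const_mul _)
          intro x
          have hw := wB_pos hN x
          have h1 : ‖ExtOp Ψ S 1 x‖ ^ p = ‖ExtOp Ψ S 1 x‖ ^ (p - 2) * ‖ExtOp Ψ S 1 x‖ ^ 2 := by
            rcases (norm_nonneg (ExtOp Ψ S 1 x)).eq_or_lt with h0 | h0
            · rw [← h0, Real.zero_rpow hp0.ne']; simp
            · rw [← Real.rpow_two, ← Real.rpow_add h0]; congr 1; ring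
          simp only
          rw [h1, mul_assoc]
          have h2 : ‖ExtOp Ψ S 1 x‖ ^ (p - 2) ≤ (N⁻¹) ^ (p - 2) :=
            Real.rpow_le_rpow (norm_nonneg _) (by simpa using hb x) (by linarith)
          gcongr
      _ = (N⁻¹) ^ (p - 2) * ∫ x, ‖ExtOp Ψ S 1 x‖ ^ 2 * wB 0 N x := integral_const_mul _ _
      _ ≤ (N⁻¹) ^ (p - 2) * (C * N⁻¹ * N ^ 2) := by
          gcongr
          refine hL.trans ?_
          gcongr
      _ = C * N ^ (3 - p) := by
          rw [Real.inv_rpow hN.le, ← Real.rpow_neg hN.le, show 3 - p = -(p - 2) + 1 by ring,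
            Real.rpow_add hN, Real.rpow_one]
          field_simp
  have hcard : ((gridIdx (Real.sqrt N)⁻¹).card : ℝ) ≤ 4 * N := by
    unfold gridIdx
    rw [Finset.card_product, Finset.card_range, inv_inv]
    push_cast
    have h1 : (⌈Real.sqrt N⌉₊ : ℝ) < Real.sqrt N + 1 := Nat.ceil_lt_add_one hsq.le
    have h2 : 1 ≤ Real.sqrt N := Real.one_le_sqrt.2 (by linarith)
    have h3 : (⌈Real.sqrt N⌉₊ : ℝ) ≤ 2 * Real.sqrt N := by linarith
    have h4 : Real.sqrt N * Real.sqrt N = N := Real.mul_self_sqrt hN.le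
    have h5 : (0:ℝ) ≤ (⌈Real.sqrt N⌉₊ : ℝ) := by positivity
    nlinarith
  have hJ : ∑ ij ∈ gridIdx (Real.sqrt N)⁻¹,
      ∫ x, |‖ExtOp Ψ (gridSq (Real.sqrt N)⁻¹ ij ∩ Q) 1 x‖| ^ p * wB 0 N x
      ≤ 4 * C * N ^ (4 - p) := by
    calc _ ≤ ∑ ij ∈ gridIdx (Real.sqrt N)⁻¹, C * N ^ (3 - p) :=
          Finset.sum_le_sum (fun ij _ => hterm ij)
      _ = ((gridIdx (Real.sqrt N)⁻¹).card : ℝ) * (C * N ^ (3 - p)) := by simp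
      _ ≤ 4 * N * (C * N ^ (3 - p)) := by gcongr
      _ = _ := by
          rw [show 4 - p = (3 - p) + 1 by ring, Real.rpow_add hN, Real.rpow_one]; ring
  have hJn : 0 ≤ ∑ ij ∈ gridIdx (Real.sqrt N)⁻¹,
      ∫ x, |‖ExtOp Ψ (gridSq (Real.sqrt N)⁻¹ ij ∩ Q) 1 x‖| ^ p * wB 0 N x := by
    apply Finset.sum_nonneg
    intro ij _
    apply integral_nonneg
    intro x
    have := wB_pos hN x
    simp only [Pi.zero_apply]; positivity
  have hfin := concl hp hI0pos hI hJn hJ (by positivity) h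
  refine le_of_eq_of_le ?_ hfin
  have h1 : I0 / (4 * C * N ^ (4 - p)) = I0 / (4 * C) * N ^ (p - 4) := by
    rw [show p - 4 = -(4 - p) by ring, Real.rpow_neg hN.le]
    field_simp
  rw [h1, Real.mul_rpow (by positivity) (by positivity), ← Real.rpow_mul hN.le]
  congr 2
  field_simp

/-! ### Second test function -/

lemma int_sq_wB {N : ℝ} (hN : 0 < N) (F : BoundedContinuousFunction R4 ℂ) :
    Integrable (fun x => ‖F x‖ ^ 2 * wB 0 N x) := by
  have := int_pow_wB hN (F := fun x => ‖F x‖) F.continuous.norm (B := ‖F‖)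
    (fun x => by rw [abs_norm]; exact F.norm_coe_le_norm x) (p := 2) (by norm_num)
  simpa only [abs_norm, Real.rpow_two] using this

lemma signs {ι : Type*} [DecidableEq ι] {N : ℝ} (hN : 0 < N)
    (F : ι → BoundedContinuousFunction R4 ℂ) (K : Finset ι) :
    ∃ ε : ι → ℝ, (∀ k, |ε k| = 1) ∧
      ∑ k ∈ K, ∫ x, ‖F k x‖ ^ 2 * wB 0 N x ≤
        ∫ x, ‖(∑ k ∈ K, (ε k : ℂ) • F k) x‖ ^ 2 * wB 0 N x := by
  induction K using Finset.induction_on with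
  | empty => exact ⟨fun _ => 1, by simp, by simp⟩
  | insert a K ha ih =>
    obtain ⟨ε, hε, hle⟩ := ih
    set G := ∑ k ∈ K, (ε k : ℂ) • F k with hG
    have hpar : (∫ x, ‖(G + F a) x‖ ^ 2 * wB 0 N x) + ∫ x, ‖(G - F a) x‖ ^ 2 * wB 0 N x =
        2 * ((∫ x, ‖G x‖ ^ 2 * wB 0 N x) + ∫ x, ‖F a x‖ ^ 2 * wB 0 N x) := by
      rw [← integral_add (int_sq_wB hN _) (int_sq_wB hN _),
        ← integral_add (int_sq_wB hN _) (int_sq_wB hN _), ← integral_const_mul]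
      congr 1; ext x
      have := parallelogram_law_with_norm ℂ (G x) (F a x)
      simp only [BoundedContinuousFunction.coe_add, BoundedContinuousFunction.coe_sub,
        Pi.add_apply, Pi.sub_apply]
      linear_combination wB 0 N x * this
    have hupd : ∀ s : ℝ, ∑ k ∈ insert a K, ((Function.update ε a s k : ℝ) : ℂ) • F k =
        (s : ℂ) • F a + G := by
      intro s
      rw [Finset.sum_insert ha, Function.update_self, hG]
      congr 1
      apply Finset.sum_congr rfl
      intro k hk
      have hne : k ≠ a := by
        rintro rfl
        exact ha hk
      rw [Function.update_of_ne hne]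
    rw [Finset.sum_insert ha]
    by_cases hcase : (∫ x, ‖(G - F a) x‖ ^ 2 * wB 0 N x) ≤ ∫ x, ‖(G + F a) x‖ ^ 2 * wB 0 N x
    · refine ⟨Function.update ε a 1, ?_, ?_⟩
      · intro k
        by_cases hk : k = a
        · subst hk; simp
        · rw [Function.update_of_ne hk]; exact hε k
      · rw [hupd, show ((1:ℝ):ℂ) • F a + G = G + F a by
          rw [Complex.ofReal_one, one_smul, add_comm]]
        linarith
    · refine ⟨Function.update ε a (-1), ?_, ?_⟩
      · intro k
        by_cases hk : k = a
        · subst hk; simp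
        · rw [Function.update_of_ne hk]; exact hε k
      · rw [hupd, show ((-1:ℝ):ℂ) • F a + G = G - F a by
          rw [Complex.ofReal_neg, Complex.ofReal_one, neg_one_smul]; abel]
        linarith

lemma interp {p : ℝ} (hp : 2 ≤ p) {y l : ℝ} (hy : 0 ≤ y) (hl : 0 < l) :
    l ^ (p - 2) * (y ^ 2 - l ^ 2) ≤ y ^ p := by
  rcases le_total y l with h | h
  · have h1 : y ^ 2 - l ^ 2 ≤ 0 := by nlinarith
    have h2 : 0 ≤ l ^ (p - 2) := by positivity
    have h3 : 0 ≤ y ^ p := by positivity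
    nlinarith
  · have hy0 : 0 < y := hl.trans_le h
    have h1 : y ^ p = y ^ (p - 2) * y ^ 2 := by
      rw [← Real.rpow_two, ← Real.rpow_add hy0]; congr 1; ring
    have h2 : l ^ (p - 2) ≤ y ^ (p - 2) := Real.rpow_le_rpow hl.le h (by linarith)
    have h3 : 0 ≤ l ^ (p - 2) := by positivity
    rw [h1]
    nlinarith [sq_nonneg y, sq_nonneg l, mul_nonneg h3 (sq_nonneg l),
      mul_le_mul_of_nonneg_right h2 (sq_nonneg y)]

lemma int_interp {p : ℝ} (hp : 2 ≤ p) {N : ℝ} (hN : 0 < N) (F : BoundedContinuousFunction R4 ℂ)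
    {l A : ℝ} (hl : 0 < l) (hA : A ≤ ∫ x, ‖F x‖ ^ 2 * wB 0 N x) :
    l ^ (p - 2) * (A - l ^ 2 * (N ^ 4 * W1)) ≤ ∫ x, |‖F x‖| ^ p * wB 0 N x := by
  have h1 := int_sq_wB hN F
  have h2 := wB_integrable hN
  calc _ ≤ l ^ (p - 2) * ((∫ x, ‖F x‖ ^ 2 * wB 0 N x) - l ^ 2 * ∫ x, wB 0 N x) := by
        rw [wB_integral hN]; gcongr
    _ = ∫ x, l ^ (p - 2) * (‖F x‖ ^ 2 * wB 0 N x - l ^ 2 * wB 0 N x) := by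
        rw [integral_const_mul, integral_sub h1 (h2.const_mul _), integral_const_mul]
    _ ≤ _ := by
        apply integral_mono ((h1.sub (h2.const_mul _)).const_mul _)
        · exact int_pow_wB hN (F := fun x => ‖F x‖) F.continuous.norm (B := ‖F‖)
            (fun x => by rw [abs_norm]; exact F.norm_coe_le_norm x) (by linarith)
        · intro x
          have hw := wB_pos hN x
          simp only [abs_norm, Pi.sub_apply]
          calc _ = l ^ (p - 2) * (‖F x‖ ^ 2 - l ^ 2) * wB 0 N x := by ring
            _ ≤ _ := by
              gcongr
              exact interp hp (norm_nonneg _) hl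

lemma exists_lip {Ψ : ℝ × ℝ → R4} (hΨ : ContDiff ℝ 3 Ψ) :
    ∃ L : ℝ, 0 ≤ L ∧ ∀ q ∈ unitSq, ∀ q' ∈ unitSq, ‖Ψ q - Ψ q'‖ ≤ L * ‖q - q'‖ := by
  have hcomp : IsCompact unitSq := isCompact_Icc.prod isCompact_Icc
  have hconv : Convex ℝ unitSq := (convex_Icc 0 1).prod (convex_Icc 0 1)
  obtain ⟨L, hL⟩ := hcomp.exists_bound_of_continuousOn
    (hΨ.continuous_fderiv (by norm_num)).continuousOn
  refine ⟨max L 0, le_max_right _ _, fun q hq q' hq' => ?_⟩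
  exact hconv.norm_image_sub_le_of_norm_fderiv_le (𝕜 := ℝ)
    (fun x _ => (hΨ.differentiable (by norm_num)) x)
    (fun x hx => (hL x hx).trans (le_max_left _ _)) hq' hq

/-- The small square inside the cell `k`. -/
def bump (δ η : ℝ) (k : ℕ × ℕ) : Set (ℝ × ℝ) := sqr ((k.1 + 1/4) * δ, (k.2 + 1/4) * δ) η

lemma bump_sub {δ η : ℝ} (hδ : 0 < δ) (_hη : 0 ≤ η) (h : η ≤ δ / 2) (k : ℕ × ℕ) :
    bump δ η k ⊆ gridSq δ k := by
  rintro ⟨t, s⟩ ⟨⟨h1, h2⟩, ⟨h3, h4⟩⟩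
  simp only at h1 h2 h3 h4
  refine ⟨⟨?_, ?_⟩, ⟨?_, ?_⟩⟩ <;> simp only <;> nlinarith

lemma cell_eq {δ η t : ℝ} (hδ : 0 < δ) (h : η ≤ δ / 2) {i j : ℕ}
    (h1 : (i + 1/4 : ℝ) * δ ≤ t) (h2 : t ≤ (i + 1/4 : ℝ) * δ + η)
    (h3 : (j : ℝ) * δ ≤ t) (h4 : t ≤ (j : ℝ) * δ + δ) : i = j := by
  have e1 : (i : ℝ) < j + 1 := by
    by_contra hc; push Not at hc; nlinarith
  have e2 : (j : ℝ) < i + 1 := by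
    by_contra hc; push Not at hc; nlinarith
  have e1' : i < j + 1 := by exact_mod_cast e1
  have e2' : j < i + 1 := by exact_mod_cast e2
  omega

lemma bump_disj {δ η : ℝ} (hδ : 0 < δ) (h : η ≤ δ / 2) {k k' : ℕ × ℕ}
    (hk : k ≠ k') : gridSq δ k' ∩ bump δ η k = ∅ := by
  rw [eq_empty_iff_forall_notMem]
  rintro ⟨t, s⟩ ⟨⟨⟨a1, a2⟩, ⟨a3, a4⟩⟩, ⟨⟨h1, h2⟩, ⟨h3, h4⟩⟩⟩
  simp only at a1 a2 a3 a4 h1 h2 h3 h4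
  exact hk (Prod.ext (cell_eq hδ h h1 h2 a1 a2) (cell_eq hδ h h3 h4 a3 a4))

lemma ExtOp_sum {Ψ : ℝ × ℝ → R4} (hΨ : Continuous Ψ) (S : Set (ℝ × ℝ)) {ι : Type*} (K : Finset ι)
    (b : ι → Set (ℝ × ℝ)) (hb : ∀ k, MeasurableSet (b k)) (hbf : ∀ k, volume (b k) ≠ ⊤)
    (ε : ι → ℝ) (x : R4) :
    ExtOp Ψ S (fun q => ∑ k ∈ K, (ε k : ℂ) * (b k).indicator 1 q) x =
      ∑ k ∈ K, (ε k : ℂ) * ExtOp Ψ (S ∩ b k) 1 x := by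
  simp_rw [← ExtOp_indicator Ψ S _ (hb _)]
  unfold ExtOp
  simp_rw [Finset.sum_mul]
  rw [integral_finsetSum]
  · apply Finset.sum_congr rfl
    intro k _
    rw [← integral_const_mul]
    congr 1; ext q; ring
  · intro k _
    have h1 : Integrable ((b k).indicator (1 : ℝ × ℝ → ℂ)) := by
      rw [integrable_indicator_iff (hb k)]
      exact integrableOn_const (hbf k)
    have h2 := (h1.const_mul (ε k : ℂ)).integrableOn (s := S)
    refine Integrable.mul_bdd (c := 1) h2 ?_ ?_
    · exact (by fun_prop : Continuous _).aestronglyMeasurable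
    · filter_upwards with q
      simp [norm_e2]

lemma caseB {Ψ : ℝ × ℝ → R4} (hΨ : ContDiff ℝ 3 Ψ) {p : ℝ} (hp : 2 ≤ p) :
    ∃ c > 0, ∀ N : ℝ, 2 ≤ N → ∀ D : ℝ,
      (∀ g : ℝ × ℝ → ℂ, IntegrableOn g unitSq → ∀ c₀ : R4,
        wLp p (wB c₀ N) (fun x => ‖ExtOp Ψ unitSq g x‖) ≤
          D * (∑ ij ∈ gridIdx ((Real.sqrt N)⁻¹),
            wLp p (wB c₀ N) (fun x => ‖ExtOp Ψ (gridSq ((Real.sqrt N)⁻¹) ij) g x‖) ^ p)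
            ^ (1/p)) → c * N ^ (1/2 - 1/p) ≤ D := by
  have hc : Continuous Ψ := hΨ.continuous
  have hp0 : 0 < p := by linarith
  obtain ⟨L, hL0, hL⟩ := exists_lip hΨ
  set V : ℝ := volume.real (Metric.closedBall (0:R4) 1) with hV
  have hVpos : 0 < V := ENNReal.toReal_pos (Metric.measure_closedBall_pos volume 0 one_pos).ne'
      measure_closedBall_lt_top.ne
  set A1 : ℝ := (1/2) ^ 2 * (2:ℝ) ^ (-(100:ℝ)) * V with hA1
  have hA1pos : 0 < A1 := by positivity
  have hW := W1_pos
  set l : ℝ := Real.sqrt (A1 / (2 * W1)) with hl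
  have hlpos : 0 < l := Real.sqrt_pos.2 (by positivity)
  have hl2 : l ^ 2 = A1 / (2 * W1) := Real.sq_sqrt (by positivity)
  set C2 : ℝ := l ^ (p - 2) * (A1 / 2) / W1 with hC2
  have hC2pos : 0 < C2 := by positivity
  refine ⟨(C2 * (1/2) ^ (p - 2)) ^ (1/p), by positivity, ?_⟩
  intro N hN2 D hD
  have hN : 0 < N := by linarith
  have hsq : 0 < Real.sqrt N := Real.sqrt_pos.2 hN
  have hsq1 : 1 ≤ Real.sqrt N := Real.one_le_sqrt.2 (by linarith)
  have hsqN : Real.sqrt N * Real.sqrt N = N := Real.mul_self_sqrt hN.le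
  set δ : ℝ := (Real.sqrt N)⁻¹ with hδ
  have hδ0 : 0 < δ := by positivity
  set a : ℝ := 1 / (6 * (L + 1)) with ha
  have ha0 : 0 < a := by positivity
  have ha6 : a ≤ 1/6 := by
    rw [ha]; apply one_div_le_one_div_of_le (by norm_num); linarith
  have haL : L * a ≤ 1/6 := by
    rw [ha, mul_one_div, div_le_iff₀ (by positivity)]; linarith
  set η : ℝ := a / N with hη
  have hη0 : 0 < η := by positivity
  have hNδ : N⁻¹ ≤ δ := by
    rw [hδ]; apply inv_anti₀ hsq; nlinarith
  have hηδ : η ≤ δ / 2 := by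
    rw [hη, div_eq_mul_inv]
    have : 0 < N⁻¹ := by positivity
    nlinarith
  set m : ℕ := ⌊Real.sqrt N⌋₊ with hm
  have hm1 : 1 ≤ m := Nat.le_floor (by simpa using hsq1)
  have hm1' : (1:ℝ) ≤ m := by exact_mod_cast hm1
  have hmle : (m:ℝ) ≤ Real.sqrt N := Nat.floor_le hsq.le
  have hmlt : Real.sqrt N < m + 1 := Nat.lt_floor_add_one _
  have hmh : Real.sqrt N * (1/2) ≤ m := by
    linarith
  set K : Finset (ℕ × ℕ) := Finset.range m ×ˢ Finset.range m with hK
  have hKcard : (K.card : ℝ) = (m:ℝ) ^ 2 := by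
    rw [hK, Finset.card_product, Finset.card_range]; push_cast; ring
  set b : ℕ × ℕ → Set (ℝ × ℝ) := bump δ η with hb
  have hbm : ∀ k, MeasurableSet (b k) := fun k => sqr_meas _ _
  have hbf : ∀ k, volume (b k) ≠ ⊤ := fun k => sqr_vol_ne _ hη0.le
  have hbv : ∀ k, volume.real (b k) = η ^ 2 := fun k => sqr_vol_real _ hη0.le
  have hgu : ∀ i : ℕ, i < m → (i : ℝ) * δ + δ ≤ 1 := by
    intro i hi
    have h1 : (i : ℝ) + 1 ≤ m := by exact_mod_cast hi
    have h2 : Real.sqrt N * δ = 1 := by rw [hδ]; exact mul_inv_cancel₀ hsq.ne'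
    nlinarith
  have hbu : ∀ k ∈ K, b k ⊆ unitSq := by
    rintro ⟨i, j⟩ hk
    rw [hK, Finset.mem_product, Finset.mem_range, Finset.mem_range] at hk
    refine (bump_sub hδ0 hη0.le hηδ (i, j)).trans ?_
    rintro ⟨t, s⟩ ⟨⟨h1, h2⟩, ⟨h3, h4⟩⟩
    simp only at h1 h2 h3 h4
    have e1 := hgu i hk.1
    have e2 := hgu j hk.2
    have e3 : 0 ≤ (i:ℝ) * δ := by positivity
    have e4 : 0 ≤ (j:ℝ) * δ := by positivity
    refine ⟨⟨?_, ?_⟩, ⟨?_, ?_⟩⟩ <;> simp only <;> linarith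
  -- the pieces
  have hFc : ∀ k, Continuous (ExtOp Ψ (b k) 1) := fun k =>
    ExtOp_cont hc (integrableOn_const (hbf k))
  have hFb : ∀ k x, ‖ExtOp Ψ (b k) 1 x‖ ≤ η ^ 2 := fun k x =>
    (ExtOp_one_norm_le (hbf k) x).trans (hbv k).le
  set F : ℕ × ℕ → BoundedContinuousFunction R4 ℂ := fun k =>
    BoundedContinuousFunction.ofNormedAddCommGroup (ExtOp Ψ (b k) 1) (hFc k) (η ^ 2) (hFb k) with hF
  have hFx : ∀ k x, F k x = ExtOp Ψ (b k) 1 x := fun k x => rfl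
  have hball : volume.real (Metric.closedBall (0:R4) N) = N ^ 4 * V := by
    rw [Measure.addHaar_real_closedBall' _ _ hN.le]
    simp [hV]
  have hFlow : ∀ k ∈ K, η ^ 4 * N ^ 4 * A1 ≤ ∫ x, ‖F k x‖ ^ 2 * wB 0 N x := by
    intro k hk
    have h1 := int_lower_ball hN (F := fun x => ‖F k x‖ ^ 2) (int_sq_wB hN (F k))
      (fun x => by positivity) (r := N) (a := (η ^ 2 / 2) ^ 2) le_rfl (by
        intro x hx
        gcongr
        rw [hFx, ← hbv k]
        set o : ℝ × ℝ := ((k.1 + 1/4) * δ, (k.2 + 1/4) * δ) with ho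
        have hob : o ∈ b k := ⟨⟨le_rfl, by simp only [ho]; linarith⟩,
          ⟨le_rfl, by simp only [ho]; linarith⟩⟩
        apply ExtOp_one_lower hc (hbm k) (hbf k) x (dot4 x (Ψ o))
        intro q hq
        rw [← dot4_sub]
        have hqo : ‖q - o‖ ≤ η := by
          obtain ⟨⟨e1, e2⟩, ⟨e3, e4⟩⟩ := hq
          rw [Prod.norm_def]
          apply max_le
          · rw [Real.norm_eq_abs, abs_le]
            simp only [ho, Prod.fst_sub] at *
            constructor <;> linarith
          · rw [Real.norm_eq_abs, abs_le]
            simp only [ho, Prod.snd_sub] at *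
            constructor <;> linarith
        calc _ ≤ ‖x‖ * ‖Ψ q - Ψ o‖ := abs_dot4_le _ _
          _ ≤ N * (L * ‖q - o‖) := by
              gcongr
              exact hL q (hbu k hk hq) o (hbu k hk hob)
          _ ≤ N * (L * η) := by gcongr
          _ = L * a := by rw [hη]; field_simp
          _ ≤ 1/6 := haL)
    rw [hball] at h1
    refine le_of_eq_of_le ?_ h1
    rw [hA1]; ring
  obtain ⟨ε, hε, hsum⟩ := signs hN F K
  set G := ∑ k ∈ K, (ε k : ℂ) • F k with hG
  have hA : (m:ℝ) ^ 2 * (η ^ 4 * N ^ 4 * A1) ≤ ∫ x, ‖G x‖ ^ 2 * wB 0 N x := by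
    refine le_trans ?_ hsum
    rw [← hKcard]
    have := Finset.sum_le_sum hFlow
    simpa using this
  have hmη : 0 < (m:ℝ) * η ^ 2 := by positivity
  have hIntg := int_interp hp hN G (l := m * η ^ 2 * l) (by positivity) hA
  set I0 : ℝ := ((m:ℝ) * η ^ 2) ^ p * N ^ 4 * (l ^ (p - 2) * (A1 / 2)) with hI0
  have hI0pos : 0 < I0 := by positivity
  have hI : I0 ≤ ∫ x, |‖G x‖| ^ p * wB 0 N x := by
    refine le_of_eq_of_le ?_ hIntg
    have e1 : ((m:ℝ) * η ^ 2) ^ p = ((m:ℝ) * η ^ 2) ^ (p - 2) * ((m:ℝ) * η ^ 2) ^ 2 := by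
      rw [← Real.rpow_two ((m:ℝ) * η ^ 2), ← Real.rpow_add hmη]; congr 1; ring
    rw [hI0, e1, Real.mul_rpow hmη.le hlpos.le, mul_pow _ l, hl2]
    field_simp
    ring
  -- the test function
  set g : ℝ × ℝ → ℂ := fun q => ∑ k ∈ K, (ε k : ℂ) * (b k).indicator 1 q with hg
  have hgi : IntegrableOn g unitSq := by
    have : Integrable g := by
      apply integrable_finsetSum
      intro k _
      apply Integrable.const_mul
      rw [integrable_indicator_iff (hbm k)]
      exact integrableOn_const (hbf k)
    exact this.integrableOn
  have h := hD g hgi 0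
  simp_rw [wLp_pow hp hN] at h
  unfold wLp at h
  have hEG : ∀ x, ExtOp Ψ unitSq g x = G x := by
    intro x
    rw [hg, ExtOp_sum hc unitSq K b hbm hbf ε x, hG]
    rw [BoundedContinuousFunction.coe_sum, Finset.sum_apply]
    apply Finset.sum_congr rfl
    intro k hk
    rw [inter_eq_right.2 (hbu k hk)]
    simp [hFx]
  simp_rw [hEG] at h
  have hEs : ∀ ij x, ‖ExtOp Ψ (gridSq δ ij) g x‖ ≤ if ij ∈ K then η ^ 2 else 0 := by
    intro ij x
    rw [hg, ExtOp_sum hc _ K b hbm hbf ε x]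
    have hzero : ∀ k, k ≠ ij → (ε k : ℂ) * ExtOp Ψ (gridSq δ ij ∩ b k) 1 x = 0 := by
      intro k hk
      rw [hb, bump_disj hδ0 hηδ hk]
      simp [ExtOp]
    split_ifs with hij
    · rw [Finset.sum_eq_single_of_mem ij hij (fun k _ hk => hzero k hk), norm_mul,
        Complex.norm_real, Real.norm_eq_abs, hε, one_mul,
        inter_eq_right.2 (bump_sub hδ0 hη0.le hηδ ij)]
      exact hFb ij x
    · rw [Finset.sum_eq_zero]
      · simp
      · intro k hk
        exact hzero k (fun e => hij (e ▸ hk))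
  have hterm : ∀ ij, ∫ x, |‖ExtOp Ψ (gridSq δ ij) g x‖| ^ p * wB 0 N x ≤
      if ij ∈ K then (η ^ 2) ^ p * (N ^ 4 * W1) else 0 := by
    intro ij
    have h0 : ∫ x, |‖ExtOp Ψ (gridSq δ ij) g x‖| ^ p * wB 0 N x ≤
        ∫ x, (if ij ∈ K then η ^ 2 else 0) ^ p * wB 0 N x := by
      apply integral_mono_of_nonneg
      · filter_upwards with x
        have := wB_pos hN x
        simp only [Pi.zero_apply]; positivity
      · exact (wB_integrable hN).const_mul _
      · filter_upwards with x
        have := wB_pos hN x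
        rw [abs_norm]
        have := hEs ij x
        gcongr
    refine h0.trans ?_
    rw [integral_const_mul, wB_integral hN]
    split_ifs
    · exact le_rfl
    · rw [Real.zero_rpow hp0.ne', zero_mul]
  have hJ : ∑ ij ∈ gridIdx δ, ∫ x, |‖ExtOp Ψ (gridSq δ ij) g x‖| ^ p * wB 0 N x ≤
      (m:ℝ) ^ 2 * ((η ^ 2) ^ p * (N ^ 4 * W1)) := by
    refine (Finset.sum_le_sum (fun ij _ => hterm ij)).trans ?_
    rw [← Finset.sum_filter, Finset.sum_const, nsmul_eq_mul, ← hKcard]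
    gcongr
    intro k hk
    exact (Finset.mem_filter.1 hk).2
  have hJn : 0 ≤ ∑ ij ∈ gridIdx δ, ∫ x, |‖ExtOp Ψ (gridSq δ ij) g x‖| ^ p * wB 0 N x := by
    apply Finset.sum_nonneg
    intro ij _
    apply integral_nonneg
    intro x
    have := wB_pos hN x
    simp only [Pi.zero_apply]; positivity
  have hfin := concl hp hI0pos hI hJn hJ (by positivity) h
  refine le_trans ?_ hfin
  have hmpos : (0:ℝ) < m := by linarith
  have e1 : I0 / ((m:ℝ) ^ 2 * ((η ^ 2) ^ p * (N ^ 4 * W1))) = C2 * (m:ℝ) ^ (p - 2) := by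
    have e2 : (m:ℝ) ^ p = (m:ℝ) ^ (p - 2) * (m:ℝ) ^ 2 := by
      rw [← Real.rpow_two (m:ℝ), ← Real.rpow_add hmpos]; congr 1; ring
    rw [hI0, hC2, Real.mul_rpow hmpos.le (by positivity), e2]
    field_simp
  rw [e1]
  have e3 : (C2 * (1/2) ^ (p - 2)) ^ (1/p) * N ^ (1/2 - 1/p) =
      (C2 * (Real.sqrt N * (1/2)) ^ (p - 2)) ^ (1/p) := by
    have e4 : N ^ (1/2 - 1/p) = ((Real.sqrt N) ^ (p - 2)) ^ (1/p) := by
      rw [Real.sqrt_eq_rpow, ← Real.rpow_mul hN.le, ← Real.rpow_mul hN.le]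
      congr 1
      field_simp
    rw [e4, ← Real.mul_rpow (by positivity) (by positivity),
      Real.mul_rpow hsq.le (by norm_num)]
    congr 1; ring
  rw [e3]
  gcongr

/-- the decoupling constant of Theorem 1.2 is essentially sharp:
any constant `D` valid for all `g` and all balls satisfies `D ≳ N^{1/2-1/p}` for
`2 ≤ p ≤ 6` and `D ≳ N^{1-4/p}` for `6 ≤ p < ∞`. -/
theorem stmt2 (Ψ : ℝ × ℝ → R4) (hΨ : ContDiff ℝ 3 Ψ) (hnd : NonDegSurf Ψ)
    (p : ℝ) (hp : 2 ≤ p) :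
    ∃ c > 0, ∀ N : ℝ, 2 ≤ N → ∀ D : ℝ,
      (∀ g : ℝ × ℝ → ℂ, IntegrableOn g unitSq → ∀ c₀ : R4,
        wLp p (wB c₀ N) (fun x => ‖ExtOp Ψ unitSq g x‖) ≤
          D * (∑ ij ∈ gridIdx ((Real.sqrt N)⁻¹),
            wLp p (wB c₀ N) (fun x => ‖ExtOp Ψ (gridSq ((Real.sqrt N)⁻¹) ij) g x‖) ^ p)
            ^ (1/p)) →
      ((p ≤ 6 → c * N ^ (1/2 - 1/p) ≤ D) ∧ (6 ≤ p → c * N ^ (1 - 4/p) ≤ D)) := by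

  obtain ⟨c1, hc1, h1⟩ := caseB hΨ hp
  obtain ⟨c2, hc2, h2⟩ := caseA hΨ hnd hp
  refine ⟨min c1 c2, lt_min hc1 hc2, fun N hN D hD => ⟨fun _ => ?_, fun _ => ?_⟩⟩
  · refine le_trans ?_ (h1 N hN D hD)
    gcongr
    exact min_le_left _ _
  · refine le_trans ?_ (h2 N hN D hD)
    gcongr
    exact min_le_right _ _
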